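/- Let δ > 0 and set r = 1 + δ. Let (X, 𝒜) be a measurable space, let g : X → ℝ be a nonnegative measurable function, and for each integer j ≥ 1 let μ_j be a finite measure on X such that μ_j(X) ≤ j^{-j·j^{1/δ}} and g(x) ≤ 2^{j+1} for μ_j-almost every x. Let μ = Σ_{j=1}^∞ μ_j. Then there exist constants c > 0 and K ∈ ℕ such that for every integer k ≥ K, ∫_X g(x)^{2k} dμ(x) ≤ exp(c·k^{r}). -/

import Mathlib

open MeasureTheory

lemma aux_real (δ : ℝ) (hδ : 0 < δ) (k : ℕ) (hk : 1 ≤ k) (j : ℕ) :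
    ((2:ℝ) ^ ((j + 1) + 1)) ^ (2 * k) * (((j + 1 : ℕ) : ℝ) ^
        (-(((j + 1 : ℕ) : ℝ) * ((j + 1 : ℕ) : ℝ) ^ ((1 : ℝ) / δ))))
      ≤ Real.exp (((5:ℝ) ^ (1 + δ) + 10) * (k : ℝ) ^ ((1 : ℝ) + δ)) * (1 / 2) ^ (j + 1) := by
  have hn1 : (1:ℝ) ≤ ((j + 1 : ℕ) : ℝ) := by exact_mod_cast Nat.le_add_left 1 j
  have hk1 : (1:ℝ) ≤ (k : ℝ) := by exact_mod_cast hk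
  have hp : ((2:ℝ) ^ ((j + 1) + 1)) ^ (2 * k)
      = Real.exp (Real.log 2 * ((((j + 1 : ℕ) : ℝ) + 1) * (2 * k))) := by
    rw [← pow_mul, ← Real.rpow_natCast, Real.rpow_def_of_pos (by norm_num)]
    push_cast
    rfl
  have hh : ((1:ℝ) / 2) ^ (j + 1) = Real.exp (-(Real.log 2 * ((j + 1 : ℕ) : ℝ))) := by
    rw [← Real.rpow_natCast, Real.rpow_def_of_pos (by norm_num), one_div, Real.log_inv, neg_mul]
  rw [hp, hh, Real.rpow_def_of_pos (by linarith), ← Real.exp_add, ← Real.exp_add]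
  apply Real.exp_le_exp.mpr
  generalize hn : j + 1 = m at *
  generalize hx : (m : ℝ) = x at *
  have hL1 : Real.log 2 ≤ 1 := by
    have := Real.log_two_lt_d9
    linarith
  have hL0 : 0 ≤ Real.log 2 := Real.log_nonneg (by norm_num)
  have hx0 : 0 ≤ Real.log x := Real.log_nonneg hn1
  have hkpow : (k : ℝ) ≤ (k : ℝ) ^ (1 + δ) := by
    simpa using Real.rpow_le_rpow_of_exponent_le hk1 (by linarith : (1:ℝ) ≤ 1 + δ)
  have h5 : (0:ℝ) < (5:ℝ) ^ (1 + δ) := by positivity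
  have hy : 0 ≤ x ^ (1 / δ) := by positivity
  have hkey : Real.log 2 * ((x + 1) * (2 * k)) + Real.log 2 * x ≤ x * (5 * k) := by
    have h1 : (x + 1) * (2 * k) + x ≤ x * (5 * k) := by
      nlinarith [mul_le_mul hn1 hk1 (by norm_num) (by linarith),
        mul_nonneg (sub_nonneg.2 hn1) (sub_nonneg.2 hk1)]
    have h2 : 0 ≤ (x + 1) * (2 * k) + x := by positivity
    nlinarith
  suffices hs : x * (5 * k) - Real.log x * (x * x ^ (1 / δ))
      ≤ ((5:ℝ) ^ (1 + δ) + 10) * (k : ℝ) ^ (1 + δ) by linarith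
  have hxy : 0 ≤ x * x ^ (1 / δ) := by positivity
  have hA : 0 ≤ Real.log x * (x * x ^ (1 / δ)) := by positivity
  have hB : 0 ≤ (5:ℝ) ^ (1 + δ) * (k : ℝ) ^ (1 + δ) := by positivity
  rcases le_or_gt (x ^ (1 / δ)) (5 * k) with h | h
  · have h1 : x ≤ (5 * k : ℝ) ^ δ := by
      have := Real.rpow_le_rpow hy h hδ.le
      rwa [← Real.rpow_mul (by linarith), one_div_mul_cancel hδ.ne', Real.rpow_one] at this
    have h2 : x * (5 * k) ≤ (5:ℝ) ^ (1 + δ) * (k : ℝ) ^ (1 + δ) := by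
      rw [← Real.mul_rpow (by norm_num) (by linarith), Real.rpow_add (by linarith),
        Real.rpow_one, mul_comm]
      exact mul_le_mul_of_nonneg_left h1 (by linarith)
    nlinarith
  · rcases le_or_gt m 2 with hm | hm
    · have h2 : x ≤ 2 := by rw [← hx]; exact_mod_cast hm
      nlinarith
    · have h3 : (3:ℝ) ≤ x := by rw [← hx]; exact_mod_cast hm
      have hl : 1 ≤ Real.log x := by
        rw [Real.le_log_iff_exp_le (by linarith)]
        have := Real.exp_one_lt_d9
        linarith
      have h4 : x * (5 * k) ≤ x * x ^ (1 / δ) := mul_le_mul_of_nonneg_left h.le (by linarith)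
      nlinarith

/-- Abstract form of the `𝔥^{1,r}` estimate in the proof of Theorem 2.5: if `μ = ∑_{j≥1} μ_j`
where `μ_j(X) ≤ j^(-j·j^(1/δ))` and `g ≤ 2^(j+1)` holds `μ_j`-a.e., then for some `c > 0`
and all large `k`, `∫ g^(2k) dμ ≤ exp (c k^(1+δ))`.
Here the measure `μ j` plays the role of `μ_{j+1}` (so `j + 1 ≥ 1` is the index in the paper). -/
theorem stmt_4 {X : Type*} [MeasurableSpace X] (δ : ℝ) (hδ : 0 < δ)
    (g : X → ℝ) (hg : Measurable g) (hg0 : ∀ x, 0 ≤ g x)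
    (μ : ℕ → Measure X) [∀ j, IsFiniteMeasure (μ j)]
    (hmass : ∀ j : ℕ, μ j Set.univ ≤
      ENNReal.ofReal (((j + 1 : ℕ) : ℝ) ^
        (-(((j + 1 : ℕ) : ℝ) * ((j + 1 : ℕ) : ℝ) ^ ((1 : ℝ) / δ)))))
    (hbd : ∀ j : ℕ, ∀ᵐ x ∂(μ j), g x ≤ 2 ^ ((j + 1) + 1)) :
    ∃ c : ℝ, 0 < c ∧ ∃ K : ℕ, ∀ k : ℕ, K ≤ k →
      ∫⁻ x, ENNReal.ofReal (g x ^ (2 * k)) ∂(Measure.sum μ)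
        ≤ ENNReal.ofReal (Real.exp (c * (k : ℝ) ^ ((1 : ℝ) + δ))) := by
  refine ⟨(5:ℝ) ^ (1 + δ) + 10, by positivity, 1, fun k hk => ?_⟩
  rw [lintegral_sum_measure]
  set E := Real.exp (((5:ℝ) ^ (1 + δ) + 10) * (k : ℝ) ^ ((1 : ℝ) + δ)) with hE
  have hE0 : 0 ≤ E := (Real.exp_pos _).le
  have hterm : ∀ j, ∫⁻ x, ENNReal.ofReal (g x ^ (2 * k)) ∂(μ j)
      ≤ ENNReal.ofReal (E * (1 / 2) ^ (j + 1)) := by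
    intro j
    calc ∫⁻ x, ENNReal.ofReal (g x ^ (2 * k)) ∂(μ j)
        ≤ ∫⁻ _, ENNReal.ofReal (((2:ℝ) ^ ((j + 1) + 1)) ^ (2 * k)) ∂(μ j) := by
          apply lintegral_mono_ae
          filter_upwards [hbd j] with x hx
          exact ENNReal.ofReal_le_ofReal (pow_le_pow_left₀ (hg0 x) hx _)
      _ = ENNReal.ofReal (((2:ℝ) ^ ((j + 1) + 1)) ^ (2 * k)) * μ j Set.univ := by
          rw [lintegral_const]
      _ ≤ _ := mul_le_mul_right (hmass j) _
      _ = _ := (ENNReal.ofReal_mul (by positivity)).symm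
      _ ≤ _ := ENNReal.ofReal_le_ofReal (aux_real δ hδ k hk j)
  have hsum : HasSum (fun j : ℕ => E * (1 / 2 : ℝ) ^ (j + 1)) E := by
    have h := (hasSum_geometric_two.mul_left (1 / 2 : ℝ)).mul_left E
    have e1 : (fun j : ℕ => E * (1 / 2 : ℝ) ^ (j + 1))
        = fun j : ℕ => E * (1 / 2 * (1 / 2 : ℝ) ^ j) := by
      funext j
      rw [pow_succ']
    have e2 : E * (1 / 2 * 2) = E := by ring
    rw [e2] at h
    rw [e1]
    exact h
  calc _ ≤ ∑' j, ENNReal.ofReal (E * (1 / 2) ^ (j + 1)) := ENNReal.tsum_le_tsum hterm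
    _ = ENNReal.ofReal E := by
      rw [← ENNReal.ofReal_tsum_of_nonneg (fun j => by positivity) hsum.summable, hsum.tsum_eq]
    _ ≤ _ := le_rfl
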